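/- (Corollary 4.5) For every M ≥ 1 there exist δ > 0 and ε > 0, depending only on M, such that the following holds. Let f : 𝕎 → ℍ be M-bilipschitz, let θ ∈ [−π/2, π/2), and let Q ∈ 𝒟 be a rectangle such that for some vertical plane 𝕍 with ∠(𝕍, 𝕎_θ) = 0 and for every horizontal line ℓ = ℝ×{t} ⊂ 𝕎 there exists a horizontal line L ⊂ 𝕍 with f(ℓ ∩ Q) ⊂ N(L, ε·ℓ(Q)). Then ℋ³(Π_θ(f(Q))) ≥ δ·ℋ³(Q). -/

import Mathlib

open scoped ENNReal

namespace HeisRug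

/-- The first Heisenberg group, as a set: ℝ³. -/
abbrev Hei : Type := ℝ × ℝ × ℝ

/-- Heisenberg group multiplication. -/
noncomputable def Hmul (p q : Hei) : Hei :=
  (p.1 + q.1, p.2.1 + q.2.1, p.2.2 + q.2.2 + (p.1 * q.2.1 - q.1 * p.2.1) / 2)

/-- Heisenberg group inverse. -/
def Hinv (p : Hei) : Hei := (-p.1, -p.2.1, -p.2.2)

/-- Homogeneous norm on the Heisenberg group. -/
noncomputable def Hnorm (p : Hei) : ℝ :=
  max (Real.sqrt (p.1 ^ 2 + p.2.1 ^ 2)) (Real.sqrt |p.2.2|)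

/-- Left-invariant metric `d(p,q) = ‖q⁻¹·p‖` on the Heisenberg group. -/
noncomputable def dH (p q : Hei) : ℝ := Hnorm (Hmul (Hinv q) p)

/-- Parabolic metric on the parabolic plane 𝕎 = ℝ². -/
noncomputable def dPar (w w' : ℝ × ℝ) : ℝ :=
  max |w.1 - w'.1| (Real.sqrt |w.2 - w'.2|)

/-- Distance from a point to a set in (ℍ, d). -/
noncomputable def distH (p : Hei) (E : Set Hei) : ℝ := sInf ((dH p) '' E)

/-- Closed δ-neighbourhood of a set in ℍ. -/
def NH (E : Set Hei) (δ : ℝ) : Set Hei := {p | distH p E ≤ δ}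

/-- Closed ball in (ℍ, d). -/
def BH (p : Hei) (r : ℝ) : Set Hei := {q | dH q p ≤ r}

/-- Closed parabolic ball in 𝕎. -/
def BPar (w : ℝ × ℝ) (r : ℝ) : Set (ℝ × ℝ) := {v | dPar v w ≤ r}

/-- Diameter (in ℝ≥0∞) with respect to the Heisenberg metric. -/
noncomputable def ediamH (E : Set Hei) : ℝ≥0∞ :=
  ⨆ p ∈ E, ⨆ q ∈ E, ENNReal.ofReal (dH p q)

/-- The 3-dimensional Hausdorff measure on (ℍ, d), as a set function. -/
noncomputable def H3 (E : Set Hei) : ℝ≥0∞ :=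
  ⨆ (δ : ℝ≥0∞) (_ : 0 < δ),
    ⨅ (U : ℕ → Set Hei) (_ : E ⊆ ⋃ n, U n) (_ : ∀ n, ediamH (U n) ≤ δ),
      ∑' n, ediamH (U n) ^ 3

/-- Isometric embedding of the parabolic plane onto the subgroup 𝕎 ⊂ ℍ. -/
def embedW (w : ℝ × ℝ) : Hei := (0, w.1, w.2)

/-- The vertical subgroup 𝕎 = {(0,y,t)} of ℍ. -/
def Wsub : Set Hei := {p | p.1 = 0}

/-- Rotation by angle θ about the t-axis. -/
noncomputable def Rrot (θ : ℝ) (p : Hei) : Hei :=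
  (p.1 * Real.cos θ - p.2.1 * Real.sin θ, p.1 * Real.sin θ + p.2.1 * Real.cos θ, p.2.2)

/-- Vertical projection Π : ℍ → 𝕎. -/
noncomputable def Piproj (p : Hei) : Hei := (0, p.2.1, p.2.2 + p.1 * p.2.1 / 2)

/-- Horizontal projection Π_𝕃 : ℍ → 𝕃. -/
def PiL (p : Hei) : Hei := (p.1, 0, 0)

/-- Vertical projection Π_θ = R_θ ∘ Π ∘ R_θ⁻¹ onto 𝕎_θ. -/
noncomputable def PiTheta (θ : ℝ) (p : Hei) : Hei := Rrot θ (Piproj (Rrot (-θ) p))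

/-- `f : 𝕎 → ℍ` is M-bilipschitz. -/
def IsBilipschitz (M : ℝ) (f : ℝ × ℝ → Hei) : Prop :=
  ∀ w w' : ℝ × ℝ,
    M⁻¹ * dPar w w' ≤ dH (f w) (f w') ∧ dH (f w) (f w') ≤ M * dPar w w'

/-- A Rickman rug: the image of the parabolic plane under a bilipschitz map. -/
def IsRickmanRug (E : Set Hei) : Prop :=
  ∃ M : ℝ, 1 ≤ M ∧ ∃ f : ℝ × ℝ → Hei, IsBilipschitz M f ∧ E = Set.range f

/-- A horizontal line in ℍ. -/
def IsHorizontalLine (L : Set Hei) : Prop :=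
  ∃ p : Hei, ∃ v : ℝ × ℝ, v ≠ 0 ∧
    L = {q | ∃ s : ℝ, q = Hmul p (s * v.1, s * v.2, 0)}

/-- The vertical plane spanned by a horizontal line. -/
def VSpan (L : Set Hei) : Set Hei := {q | ∃ p ∈ L, ∃ t : ℝ, q = Hmul p (0, 0, t)}

/-- Vertical planes in ℍ. -/
def IsVerticalPlane (V : Set Hei) : Prop :=
  ∃ L : Set Hei, IsHorizontalLine L ∧ V = VSpan L

/-- The horizontal line {(a·y + b, y, b·y/2 + c) : y ∈ ℝ} (of slope |a|). -/
def hline (a b c : ℝ) : Set Hei :=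
  {p | ∃ y : ℝ, p = (a * y + b, y, b * y / 2 + c)}

/-- A horizontal line of (finite) slope at most Σ. -/
def HLineSlopeLe (S : ℝ) (L : Set Hei) : Prop :=
  ∃ a b c : ℝ, |a| ≤ S ∧ L = hline a b c

/-- A vertical plane of (finite) slope at most Σ (relative to 𝕎). -/
def VPlaneSlopeLe (S : ℝ) (V : Set Hei) : Prop :=
  ∃ a b : ℝ, |a| ≤ S ∧ V = {p : Hei | p.1 = a * p.2.1 + b}

/-- A vertical plane whose slope relative to 𝕎_θ equals 0. -/
def SlopeZeroRel (θ : ℝ) (V : Set Hei) : Prop :=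
  ∃ b : ℝ, Rrot (-θ) '' V = {p : Hei | p.1 = b}

/-- The horizontal line ℝ × {t} in the parabolic plane. -/
def lineW (t : ℝ) : Set (ℝ × ℝ) := {w | w.2 = t}

/-- Ruler coefficient ρ_f(B_par(w,r)). -/
noncomputable def rulerCoef (f : ℝ × ℝ → Hei) (w : ℝ × ℝ) (r : ℝ) : ℝ :=
  sInf {ρ : ℝ | 0 < ρ ∧ ∀ t : ℝ, ∃ L : Set Hei, IsHorizontalLine L ∧
    f '' (lineW t ∩ BPar w r) ⊆ NH L (ρ * r)}

/-- β_f(𝕍; B_par(w,r)): approximation number relative to the vertical plane 𝕍. -/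
noncomputable def betaV (f : ℝ × ℝ → Hei) (V : Set Hei) (w : ℝ × ℝ) (r : ℝ) : ℝ :=
  sInf {ε : ℝ | 0 < ε ∧ ∀ t : ℝ, ∃ L : Set Hei, IsHorizontalLine L ∧ L ⊆ V ∧
    f '' (lineW t ∩ BPar w r) ⊆ NH L (ε * r)}

/-- The strong vertical β-number β_f(B_par(w,r)) = inf_𝕍 β_f(𝕍; B_par(w,r)). -/
noncomputable def beta (f : ℝ × ℝ → Hei) (w : ℝ × ℝ) (r : ℝ) : ℝ :=
  sInf {b : ℝ | ∃ V : Set Hei, IsVerticalPlane V ∧ b = betaV f V w r}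

/-- Index set for dyadic parabolic rectangles: (n, k, l). -/
abbrev Idx : Type := ℤ × ℤ × ℤ

/-- Side length ℓ(Q) = 2⁻ⁿ of the dyadic parabolic rectangle with index (n,k,l). -/
noncomputable def sideLen (i : Idx) : ℝ := (2 : ℝ) ^ (-i.1)

/-- The dyadic parabolic rectangle [k·2⁻ⁿ, (k+1)·2⁻ⁿ) × [l·4⁻ⁿ, (l+1)·4⁻ⁿ). -/
noncomputable def rect (i : Idx) : Set (ℝ × ℝ) :=
  Set.Ico ((i.2.1 : ℝ) * (2 : ℝ) ^ (-i.1)) (((i.2.1 : ℝ) + 1) * (2 : ℝ) ^ (-i.1)) ×ˢ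
  Set.Ico ((i.2.2 : ℝ) * (4 : ℝ) ^ (-i.1)) (((i.2.2 : ℝ) + 1) * (4 : ℝ) ^ (-i.1))

/-- The centre c_Q of a dyadic parabolic rectangle. -/
noncomputable def center (i : Idx) : ℝ × ℝ :=
  (((i.2.1 : ℝ) + 1 / 2) * (2 : ℝ) ^ (-i.1), ((i.2.2 : ℝ) + 1 / 2) * (4 : ℝ) ^ (-i.1))

/-- λQ := B_par(c_Q, λ·ℓ(Q)). -/
noncomputable def dilate (lam : ℝ) (i : Idx) : Set (ℝ × ℝ) := BPar (center i) (lam * sideLen i)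

/-- j indexes a 𝒟-child of the rectangle indexed by i. -/
def IsChild (j i : Idx) : Prop := j.1 = i.1 + 1 ∧ rect j ⊆ rect i

/-- T ⊆ 𝒟 is a tree with root rt. -/
def IsTreeWithRoot (T : Set Idx) (rt : Idx) : Prop :=
  rt ∈ T ∧ (∀ i ∈ T, rect i ⊆ rect rt) ∧
  (∀ i j k : Idx, i ∈ T → k ∈ T → rect i ⊆ rect j → rect j ⊆ rect k → j ∈ T) ∧
  (∀ i ∈ T, (∀ j : Idx, IsChild j i → j ∈ T) ∨ (∀ j : Idx, IsChild j i → j ∉ T))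

/-- T ⊆ 𝒟 is a tree. -/
def IsTree (T : Set Idx) : Prop := ∃ rt : Idx, IsTreeWithRoot T rt

/-- Q is (ε,H,Σ)-vertical for f : there is a vertical plane 𝕍_Q of slope ≤ Σ with
β_f(𝕍_Q; HQ) < ε/H. -/
def IsVerticalRect (f : ℝ × ℝ → Hei) (ε Hc S : ℝ) (i : Idx) : Prop :=
  ∃ V : Set Hei, VPlaneSlopeLe S V ∧ betaV f V (center i) (Hc * sideLen i) < ε / Hc

/-- Q is (δ,C)-ruled for f. -/
def IsRuled (f : ℝ × ℝ → Hei) (δ C : ℝ) (i : Idx) : Prop :=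
  ∀ t : ℝ, ∃ L : Set Hei, IsHorizontalLine L ∧
    f '' (lineW t ∩ dilate C i) ⊆ NH L (δ * sideLen i)

/-- Q is (δ,C,Σ)-ruled for f. -/
def IsRuledSlope (f : ℝ × ℝ → Hei) (δ C S : ℝ) (i : Idx) : Prop :=
  IsRuled f δ C i ∧ ∃ t : ℝ, (lineW t ∩ rect i).Nonempty ∧
    ∃ L : Set Hei, HLineSlopeLe S L ∧
      f '' (lineW t ∩ dilate C i) ⊆ NH L (δ * sideLen i)

/-- Γ is an intrinsic L-Lipschitz graph over 𝕎. -/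
def IsIntrinsicLipGraph (L : ℝ) (Γ : Set Hei) : Prop :=
  Set.BijOn Piproj Γ Wsub ∧
  ∀ p ∈ Γ, ∀ q ∈ Γ,
    Hnorm (PiL (Hmul (Hinv q) p)) ≤ L * Hnorm (Piproj (Hmul (Hinv q) p))

/-- Γ is an intrinsic L-Lipschitz graph over 𝕎_θ. -/
def IsIntrinsicLipGraphOver (θ L : ℝ) (Γ : Set Hei) : Prop :=
  IsIntrinsicLipGraph L (Rrot (-θ) '' Γ)

/-- An intrinsic bilipschitz graph: an intrinsic Lipschitz graph over some vertical
subgroup which is also a Rickman rug. -/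
def IsIntrinsicBilipGraph (Γ : Set Hei) : Prop :=
  (∃ θ ∈ Set.Ico (-(Real.pi / 2)) (Real.pi / 2), ∃ L : ℝ, 1 ≤ L ∧
    IsIntrinsicLipGraphOver θ L Γ) ∧ IsRickmanRug Γ

/-- (M,ε)-quasi-isometric embedding between sets with distance functions. -/
def IsQIEOn {X Y : Type*} (dX : X → X → ℝ) (dY : Y → Y → ℝ) (A : Set X)
    (M ε : ℝ) (F : X → Y) : Prop :=
  ∀ x ∈ A, ∀ x' ∈ A,
    M⁻¹ * dX x x' - ε ≤ dY (F x) (F x') ∧ dY (F x) (F x') ≤ M * dX x x' + ε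

/-- d is a metric on ℝ. -/
def IsMetricOn (d : ℝ → ℝ → ℝ) : Prop :=
  (∀ x y, d x y = d y x) ∧ (∀ x y, d x y = 0 ↔ x = y) ∧
  (∀ x y z, d x z ≤ d x y + d y z)

/-- d is an orderly metric on ℝ. -/
def Orderly (d : ℝ → ℝ → ℝ) : Prop :=
  IsMetricOn d ∧
  (∀ x : ℝ, ∀ ε > (0 : ℝ), ∃ δ > (0 : ℝ), ∀ y : ℝ, |x - y| < δ → d x y < ε) ∧
  (∀ x y z : ℝ, x ≤ y → y ≤ z → max (d x y) (d y z) ≤ d x z)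

/-- F : I×J → 𝕎 is a horizontal (M,ε)-QIE. -/
def IsHorizQIE (M ε : ℝ) (I J : Set ℝ) (F : ℝ × ℝ → ℝ × ℝ) : Prop :=
  IsQIEOn dPar dPar (I ×ˢ J) M ε F ∧
  (∀ t ∈ J, ∃ c : ℝ, ∀ y ∈ I, (F (y, t)).2 = c)


theorem angle_incr (ψ : ℝ → ℝ) (a b : ℝ) (hab : a ≤ b) (hc : ContinuousOn ψ (Set.Icc a b))
    (hcos : ∀ s ∈ Set.Icc a b, 0 < Real.cos (ψ s)) (ha : Real.sin (ψ a) < 0)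
    (hb : 0 < Real.sin (ψ b)) : ψ a < ψ b := by
  by_contra hle
  push Not at hle
  have h1 : ψ a - ψ b < Real.pi := by
    by_contra h
    push Not at h
    have hpi := Real.pi_pos
    set n : ℤ := ⌈(ψ b - Real.pi / 2) / Real.pi⌉ with hn
    have e1 : (ψ b - Real.pi / 2) / Real.pi ≤ n := Int.le_ceil _
    have e2 : (n : ℝ) < (ψ b - Real.pi / 2) / Real.pi + 1 := Int.ceil_lt_add_one _
    rw [div_le_iff₀ hpi] at e1
    have e3 : (n : ℝ) * Real.pi < ψ b - Real.pi / 2 + Real.pi := by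
      have := mul_lt_mul_of_pos_right e2 hpi
      rwa [add_mul, div_mul_cancel₀ _ hpi.ne', one_mul] at this
    have hm : (n : ℝ) * Real.pi + Real.pi / 2 ∈ Set.Icc (ψ b) (ψ a) := ⟨by linarith, by linarith⟩
    obtain ⟨s, hs, hs'⟩ := intermediate_value_Icc' hab hc hm
    have := hcos s hs
    have h0 : Real.cos (ψ s) = 0 := by
      rw [Real.cos_eq_zero_iff]
      exact ⟨n, by rw [hs']; ring⟩
    linarith
  have h2 : 0 ≤ Real.sin (ψ a - ψ b) := Real.sin_nonneg_of_nonneg_of_le_pi (by linarith) h1.le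
  rw [Real.sin_sub] at h2
  have ca := hcos a ⟨le_rfl, hab⟩
  have cb := hcos b ⟨hab, le_rfl⟩
  nlinarith [mul_pos ca hb, mul_pos cb (neg_pos.2 ha)]

theorem poincare_miranda (G : ℝ × ℝ → ℝ × ℝ) (y0 y1 t0 t1 : ℝ) (hy : y0 ≤ y1) (ht : t0 ≤ t1)
    (hG : ContinuousOn G (Set.Icc y0 y1 ×ˢ Set.Icc t0 t1))
    (hl : ∀ t ∈ Set.Icc t0 t1, (G (y0, t)).1 < 0) (hr : ∀ t ∈ Set.Icc t0 t1, 0 < (G (y1, t)).1)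
    (hb : ∀ y ∈ Set.Icc y0 y1, (G (y, t0)).2 < 0) (htp : ∀ y ∈ Set.Icc y0 y1, 0 < (G (y, t1)).2) :
    ∃ w ∈ Set.Icc y0 y1 ×ˢ Set.Icc t0 t1, G w = (0, 0) := by
  by_contra hne
  push Not at hne
  let P : ℝ × ℝ → ℝ × ℝ := fun w => (max y0 (min y1 w.1), max t0 (min t1 w.2))
  have hPc : Continuous P := by fun_prop
  have hPm : ∀ w, P w ∈ Set.Icc y0 y1 ×ˢ Set.Icc t0 t1 := fun w =>
    ⟨⟨le_max_left _ _, max_le hy (min_le_left _ _)⟩, ⟨le_max_left _ _, max_le ht (min_le_left _ _)⟩⟩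
  have hPid : ∀ w ∈ Set.Icc y0 y1 ×ˢ Set.Icc t0 t1, P w = w := by
    rintro ⟨u, v⟩ ⟨⟨h1, h2⟩, ⟨h3, h4⟩⟩
    simp only [P]
    simp only at h1 h2 h3 h4
    rw [min_eq_right h2, max_eq_right h1, min_eq_right h4, max_eq_right h3]
  have hGP : Continuous (fun w => G (P w)) := hG.comp_continuous hPc hPm
  let g : C(ℝ × ℝ, ℂ) := ⟨fun w => ((G (P w)).1 : ℂ) + ((G (P w)).2 : ℂ) * Complex.I, by
    have c1 := Complex.continuous_ofReal.comp (continuous_fst.comp hGP)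
    have c2 := Complex.continuous_ofReal.comp (continuous_snd.comp hGP)
    exact c1.add (c2.mul continuous_const)⟩
  have hg0 : ∀ w, g w ≠ 0 := by
    intro w h
    have h1 := congrArg Complex.re h
    have h2 := congrArg Complex.im h
    simp [g] at h1 h2
    exact hne _ (hPm w) (Prod.ext h1 h2)
  obtain ⟨φ, ⟨-, hφ⟩, -⟩ := Complex.isCoveringMapOn_exp.existsUnique_continuousMap_lifts g
    (a₀ := (0, 0)) (Complex.exp_log (hg0 (0, 0))) (fun a => hg0 a)
  have hcs : ∀ w ∈ Set.Icc y0 y1 ×ˢ Set.Icc t0 t1,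
      Real.exp (φ w).re * Real.cos (φ w).im = (G w).1 ∧
      Real.exp (φ w).re * Real.sin (φ w).im = (G w).2 := by
    intro w hw
    have h := congrFun hφ w
    simp only [Function.comp_apply] at h
    have h1 := congrArg Complex.re h
    have h2 := congrArg Complex.im h
    rw [Complex.exp_re] at h1
    rw [Complex.exp_im] at h2
    simp [g, hPid w hw] at h1 h2
    exact ⟨h1, h2⟩
  have cpos : ∀ w ∈ Set.Icc y0 y1 ×ˢ Set.Icc t0 t1, 0 < (G w).1 → 0 < Real.cos (φ w).im := by
    intro w hw h
    rw [← (hcs w hw).1] at h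
    exact pos_of_mul_pos_right h (Real.exp_pos _).le
  have cneg : ∀ w ∈ Set.Icc y0 y1 ×ˢ Set.Icc t0 t1, (G w).1 < 0 → Real.cos (φ w).im < 0 := by
    intro w hw h
    rw [← (hcs w hw).1] at h
    exact neg_of_mul_neg_right h (Real.exp_pos _).le
  have spos : ∀ w ∈ Set.Icc y0 y1 ×ˢ Set.Icc t0 t1, 0 < (G w).2 → 0 < Real.sin (φ w).im := by
    intro w hw h
    rw [← (hcs w hw).2] at h
    exact pos_of_mul_pos_right h (Real.exp_pos _).le
  have sneg : ∀ w ∈ Set.Icc y0 y1 ×ˢ Set.Icc t0 t1, (G w).2 < 0 → Real.sin (φ w).im < 0 := by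
    intro w hw h
    rw [← (hcs w hw).2] at h
    exact neg_of_mul_neg_right h (Real.exp_pos _).le
  have my0 : y0 ∈ Set.Icc y0 y1 := ⟨le_rfl, hy⟩
  have my1 : y1 ∈ Set.Icc y0 y1 := ⟨hy, le_rfl⟩
  have mt0 : t0 ∈ Set.Icc t0 t1 := ⟨le_rfl, ht⟩
  have mt1 : t1 ∈ Set.Icc t0 t1 := ⟨ht, le_rfl⟩
  have hφc : Continuous fun w => (φ w).im := Complex.continuous_im.comp φ.continuous
  have r := angle_incr (fun t => (φ (y1, t)).im) t0 t1 ht (by fun_prop)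
    (fun t h => cpos _ ⟨my1, h⟩ (hr t h)) (sneg _ ⟨my1, mt0⟩ (hb _ my1))
    (spos _ ⟨my1, mt1⟩ (htp _ my1))
  have l := angle_incr (fun t => (φ (y0, -t)).im - Real.pi) (-t1) (-t0) (by linarith) (by fun_prop)
    (fun t h => by
      have h' : -t ∈ Set.Icc t0 t1 := ⟨by linarith [h.2], by linarith [h.1]⟩
      have := cneg _ ⟨my0, h'⟩ (hl _ h')
      rw [Real.cos_sub_pi]; linarith)
    (by rw [neg_neg, Real.sin_sub_pi]; linarith [spos _ ⟨my0, mt1⟩ (htp _ my0)])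
    (by rw [neg_neg, Real.sin_sub_pi]; linarith [sneg _ ⟨my0, mt0⟩ (hb _ my0)])
  have tp := angle_incr (fun y => (φ (-y, t1)).im - Real.pi / 2) (-y1) (-y0) (by linarith)
    (by fun_prop)
    (fun y h => by
      have h' : -y ∈ Set.Icc y0 y1 := ⟨by linarith [h.2], by linarith [h.1]⟩
      have := spos _ ⟨h', mt1⟩ (htp _ h')
      rw [Real.cos_sub_pi_div_two]; linarith)
    (by rw [neg_neg, Real.sin_sub_pi_div_two]; linarith [cpos _ ⟨my1, mt1⟩ (hr _ mt1)])
    (by rw [neg_neg, Real.sin_sub_pi_div_two]; linarith [cneg _ ⟨my0, mt1⟩ (hl _ mt1)])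
  have bt := angle_incr (fun y => (φ (y, t0)).im + Real.pi / 2) y0 y1 hy
    (by fun_prop)
    (fun y h => by
      have := sneg _ ⟨h, mt0⟩ (hb _ h)
      rw [Real.cos_add_pi_div_two]; linarith)
    (by rw [Real.sin_add_pi_div_two]; linarith [cneg _ ⟨my0, mt0⟩ (hl _ mt0)])
    (by rw [Real.sin_add_pi_div_two]; linarith [cpos _ ⟨my1, mt0⟩ (hr _ mt0)])
  simp only [neg_neg] at r l tp bt
  linarith

theorem dH_rot_embed (θ : ℝ) (w w' : ℝ × ℝ) :
    dH (Rrot θ (embedW w)) (Rrot θ (embedW w')) = dPar w w' := by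
  have h1 : Real.cos θ ^ 2 = 1 - Real.sin θ ^ 2 := by linarith [Real.sin_sq_add_cos_sq θ]
  unfold dH Rrot embedW Hmul Hinv Hnorm dPar
  simp only
  congr 1
  · rw [← Real.sqrt_sq_eq_abs]
    congr 1
    ring_nf
    rw [h1]
    ring
  · congr 2
    ring

theorem vol_le_ediam (θ : ℝ) (U : Set Hei) :
    MeasureTheory.volume ((fun w => Rrot θ (embedW w)) ⁻¹' U) ≤ ediamH U ^ 3 := by
  set S := (fun w => Rrot θ (embedW w)) ⁻¹' U with hS
  have hd : ∀ w ∈ S, ∀ w' ∈ S, ENNReal.ofReal (dPar w w') ≤ ediamH U := by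
    intro w hw w' hw'
    rw [← dH_rot_embed θ]
    unfold ediamH
    exact le_iSup₂_of_le (Rrot θ (embedW w)) hw (le_iSup₂_of_le (Rrot θ (embedW w')) hw' le_rfl)
  have h1 : MeasureTheory.volume (Prod.fst '' S) ≤ ediamH U := by
    refine (Real.volume_le_diam _).trans (Metric.ediam_le ?_)
    rintro _ ⟨w, hw, rfl⟩ _ ⟨w', hw', rfl⟩
    rw [edist_dist, Real.dist_eq]
    exact (ENNReal.ofReal_le_ofReal (le_max_left _ _)).trans (hd w hw w' hw')
  have h2 : MeasureTheory.volume (Prod.snd '' S) ≤ ediamH U ^ 2 := by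
    refine (Real.volume_le_diam _).trans (Metric.ediam_le ?_)
    rintro _ ⟨w, hw, rfl⟩ _ ⟨w', hw', rfl⟩
    rw [edist_dist, Real.dist_eq, ← Real.sq_sqrt (abs_nonneg (w.2 - w'.2)),
      ENNReal.ofReal_pow (Real.sqrt_nonneg _)]
    gcongr
    exact (ENNReal.ofReal_le_ofReal (le_max_right _ _)).trans (hd w hw w' hw')
  calc MeasureTheory.volume S
      ≤ MeasureTheory.volume ((Prod.fst '' S) ×ˢ (Prod.snd '' S)) :=
        MeasureTheory.measure_mono fun w hw => ⟨⟨w, hw, rfl⟩, ⟨w, hw, rfl⟩⟩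
    _ = MeasureTheory.volume (Prod.fst '' S) * MeasureTheory.volume (Prod.snd '' S) := by
        rw [MeasureTheory.Measure.volume_eq_prod, MeasureTheory.Measure.prod_prod]
    _ ≤ ediamH U * ediamH U ^ 2 := by gcongr
    _ = ediamH U ^ 3 := by ring

theorem H3_lower (θ : ℝ) (A : Set (ℝ × ℝ)) :
    MeasureTheory.volume A ≤ H3 ((fun w => Rrot θ (embedW w)) '' A) := by
  unfold H3
  refine le_iSup₂_of_le ⊤ ENNReal.zero_lt_top ?_
  refine le_iInf fun U => le_iInf fun hU => le_iInf fun _ => ?_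
  calc MeasureTheory.volume A
      ≤ MeasureTheory.volume (⋃ n, (fun w => Rrot θ (embedW w)) ⁻¹' U n) := by
        refine MeasureTheory.measure_mono fun w hw => ?_
        have := hU ⟨w, hw, rfl⟩
        rw [Set.mem_iUnion] at this ⊢
        exact this
    _ ≤ ∑' n, MeasureTheory.volume ((fun w => Rrot θ (embedW w)) ⁻¹' U n) :=
        MeasureTheory.measure_iUnion_le _
    _ ≤ ∑' n, ediamH (U n) ^ 3 := ENNReal.tsum_le_tsum fun n => vol_le_ediam θ _

theorem ediam_piece (a b r : ℝ) (hr : 0 ≤ r) :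
    ediamH (embedW '' (Set.Ico a (a + r) ×ˢ Set.Ico b (b + r ^ 2))) ≤ ENNReal.ofReal r := by
  unfold ediamH
  refine iSup₂_le fun p hp => iSup₂_le fun q hq => ENNReal.ofReal_le_ofReal ?_
  obtain ⟨w, ⟨⟨h1, h2⟩, ⟨h3, h4⟩⟩, rfl⟩ := hp
  obtain ⟨w', ⟨⟨h1', h2'⟩, ⟨h3', h4'⟩⟩, rfl⟩ := hq
  have := dH_rot_embed 0 w w'
  simp only [Rrot, Real.cos_zero, Real.sin_zero, mul_one, mul_zero, sub_zero, zero_add] at this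
  change dH (embedW w) (embedW w') = _ at this
  rw [this]
  refine max_le (abs_le.2 ⟨by linarith, by linarith⟩) ?_
  rw [← Real.sqrt_sq hr]
  exact Real.sqrt_le_sqrt (abs_le.2 ⟨by linarith, by linarith⟩)

theorem exists_piece (a r x : ℝ) (hr : 0 < r) (K : ℕ) (hx : x ∈ Set.Ico a (a + K * r)) :
    ∃ j : Fin K, x ∈ Set.Ico (a + (j : ℕ) * r) (a + (j : ℕ) * r + r) := by
  have h0 : 0 ≤ (x - a) / r := div_nonneg (by linarith [hx.1]) hr.le
  have h1 : (x - a) / r < K := by rw [div_lt_iff₀ hr]; linarith [hx.2]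
  refine ⟨⟨⌊(x - a) / r⌋₊, (Nat.floor_lt h0).2 h1⟩, ?_, ?_⟩
  · have := Nat.floor_le h0
    rw [le_div_iff₀ hr] at this
    simp only
    linarith
  · have := Nat.lt_floor_add_one ((x - a) / r)
    rw [div_lt_iff₀ hr] at this
    simp only
    linarith

theorem H3_upper (a b l : ℝ) (hl : 0 < l) :
    H3 (embedW '' (Set.Ico a (a + l) ×ˢ Set.Ico b (b + l ^ 2))) ≤ ENNReal.ofReal (l ^ 3) := by
  unfold H3
  refine iSup₂_le fun δ hδ => ?_
  obtain ⟨N, hN0, hN⟩ : ∃ N : ℕ, 0 < N ∧ ENNReal.ofReal (l / N) ≤ δ := by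
    rcases eq_or_ne δ ⊤ with rfl | hδt
    · exact ⟨1, one_pos, le_top⟩
    · have hδr : 0 < δ.toReal := ENNReal.toReal_pos hδ.ne' hδt
      obtain ⟨N, hN⟩ := exists_nat_gt (l / δ.toReal)
      have hNp : (0 : ℝ) < N := lt_trans (div_pos hl hδr) hN
      refine ⟨N, by exact_mod_cast hNp, ?_⟩
      rw [ENNReal.ofReal_le_iff_le_toReal hδt, div_le_iff₀ hNp]
      rw [div_lt_iff₀ hδr] at hN
      linarith
  have hNr : (0 : ℝ) < N := by exact_mod_cast hN0
  set r : ℝ := l / N with hr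
  have hr0 : 0 < r := div_pos hl hNr
  have hNl : N * r = l := by rw [hr]; field_simp
  let s : Fin N × Fin (N ^ 2) → Set Hei := fun j =>
    embedW '' (Set.Ico (a + (j.1 : ℕ) * r) (a + (j.1 : ℕ) * r + r) ×ˢ
      Set.Ico (b + (j.2 : ℕ) * r ^ 2) (b + (j.2 : ℕ) * r ^ 2 + r ^ 2))
  have hemp : ediamH ∅ = 0 := by simp [ediamH]
  have hs : ∀ j, ediamH (s j) ≤ ENNReal.ofReal r := fun j => ediam_piece _ _ _ hr0.le
  refine iInf_le_of_le (fun n => ⋃ j ∈ Encodable.decode₂ _ n, s j) (iInf_le_of_le ?_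
    (iInf_le_of_le ?_ ?_))
  · rw [Encodable.iUnion_decode₂]
    rintro _ ⟨w, ⟨hw1, hw2⟩, rfl⟩
    rw [← hNl] at hw1 hw2
    obtain ⟨j1, h1⟩ := exists_piece a r w.1 hr0 N hw1
    obtain ⟨j2, h2⟩ := exists_piece b (r ^ 2) w.2 (by positivity) (N ^ 2)
      (by push_cast; rw [← mul_pow]; exact hw2)
    exact Set.mem_iUnion.2 ⟨(j1, j2), w, ⟨h1, h2⟩, rfl⟩
  · intro n
    refine Encodable.iUnion_decode₂_cases (C := fun S => ediamH S ≤ δ) ?_ ?_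
    · rw [hemp]; exact zero_le
    · exact fun j => (hs j).trans hN
  · rw [tsum_iUnion_decode₂ (fun S => ediamH S ^ 3) (by simp [hemp])]
    calc ∑' j, ediamH (s j) ^ 3 ≤ ∑' j : Fin N × Fin (N ^ 2), ENNReal.ofReal r ^ 3 :=
          ENNReal.tsum_le_tsum fun j => by gcongr; exact hs j
      _ = ENNReal.ofReal (l ^ 3) := by
          rw [tsum_fintype, Finset.sum_const, Finset.card_univ, Fintype.card_prod, Fintype.card_fin,
            Fintype.card_fin, nsmul_eq_mul, ← ENNReal.ofReal_pow hr0.le, ← ENNReal.ofReal_natCast,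
            ← ENNReal.ofReal_mul (by positivity)]
          congr 1
          rw [← hNl]; push_cast; ring
      _ ≤ _ := le_rfl

theorem sign_exists (x : ℝ) : ∃ σ : ℝ, |σ| = 1 ∧ σ * x = |x| := by
  rcases le_total 0 x with h | h
  · exact ⟨1, by simp, by rw [abs_of_nonneg h, one_mul]⟩
  · exact ⟨-1, by simp, by rw [abs_of_nonpos h]; ring⟩

theorem sign_mul_le {σ : ℝ} (hσ : |σ| = 1) (x : ℝ) : |σ * x| ≤ |x| := by
  rw [abs_mul, hσ, one_mul]

set_option maxHeartbeats 1000000 in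
theorem planar (M ρ y0 t0 : ℝ) (hM : 1 ≤ M) (hρ : 0 < ρ) (Q : Set (ℝ × ℝ))
    (hQ : Q = Set.Ico y0 (y0 + 32 * ρ * M ^ 3) ×ˢ Set.Ico t0 (t0 + (32 * ρ * M ^ 3) ^ 2))
    (F : ℝ × ℝ → ℝ × ℝ)
    (hA1 : ∀ w ∈ Q, ∀ w' ∈ Q, |(F w).1 - (F w').1| ≤ M * dPar w w')
    (hA2 : ∀ w ∈ Q, ∀ w' ∈ Q,
      |(F w).2 - (F w').2| ≤ (M * dPar w w') ^ 2 + ρ / 4 * (M * dPar w w'))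
    (hB : ∀ w ∈ Q, ∀ w' ∈ Q, dPar w w' ^ 2 ≤ M ^ 2 *
      max (4 * (ρ / 4) ^ 2 + ((F w).1 - (F w').1) ^ 2)
        (|(F w).2 - (F w').2| + ρ / 4 * |(F w).1 - (F w').1|))
    (hC : ∀ w ∈ Q, ∀ w' ∈ Q, w.2 = w'.2 → |(F w).2 - (F w').2| ≤ 4 * (ρ / 4) ^ 2) :
    ∃ m1 m2 : ℝ, Set.Ioo (m1 - 2 * (ρ * M ^ 2)) (m1 + 2 * (ρ * M ^ 2)) ×ˢ
      Set.Ioo (m2 - ρ ^ 2 / 4) (m2 + ρ ^ 2 / 4) ⊆ F '' Q := by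
  have hM0 : 0 < M := by linarith
  set h : ℝ := 16 * ρ * M ^ 3 with hh
  set s : ℝ := ρ * M with hs
  have hh0 : 0 < h := by positivity
  have hs0 : 0 < s := by positivity
  have hM3 : M ≤ M ^ 3 := le_self_pow₀ hM (by norm_num)
  have hM2 : 1 ≤ M ^ 2 := one_le_pow₀ hM
  have hsl : s < 32 * ρ * M ^ 3 := by
    rw [hs]; nlinarith [mul_le_mul_of_nonneg_left hM3 hρ.le, mul_pos hρ hM0]
  set y1 := y0 + h with hy1
  set t1 := t0 + s ^ 2 with ht1
  have hy : y0 ≤ y1 := by linarith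
  have ht : t0 ≤ t1 := by nlinarith
  have hKQ : Set.Icc y0 y1 ×ˢ Set.Icc t0 t1 ⊆ Q := by
    rw [hQ]
    rintro w ⟨⟨h1, h2⟩, ⟨h3, h4⟩⟩
    refine ⟨⟨h1, ?_⟩, ⟨h3, ?_⟩⟩
    · have : 32 * ρ * M ^ 3 = 2 * h := by rw [hh]; ring
      linarith
    · have : s ^ 2 < (32 * ρ * M ^ 3) ^ 2 := by gcongr
      linarith
  have my0 : y0 ∈ Set.Icc y0 y1 := ⟨le_rfl, hy⟩
  have my1 : y1 ∈ Set.Icc y0 y1 := ⟨hy, le_rfl⟩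
  have mt0 : t0 ∈ Set.Icc t0 t1 := ⟨le_rfl, ht⟩
  have mt1 : t1 ∈ Set.Icc t0 t1 := ⟨ht, le_rfl⟩
  -- continuity
  have hdc : Continuous fun p : (ℝ × ℝ) × (ℝ × ℝ) => dPar p.1 p.2 := by
    unfold dPar; fun_prop
  have hFc : ContinuousOn F (Set.Icc y0 y1 ×ˢ Set.Icc t0 t1) := by
    intro w0 hw0
    have hd0 : Filter.Tendsto (fun w => dPar w w0)
        (nhdsWithin w0 (Set.Icc y0 y1 ×ˢ Set.Icc t0 t1)) (nhds 0) := by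
      have hc : Continuous fun w => dPar w w0 := by unfold dPar; fun_prop
      have := hc.tendsto w0
      have h0 : dPar w0 w0 = 0 := by simp [dPar]
      rw [h0] at this
      exact this.mono_left nhdsWithin_le_nhds
    have e1 : Filter.Tendsto (fun w => (F w).1)
        (nhdsWithin w0 (Set.Icc y0 y1 ×ˢ Set.Icc t0 t1)) (nhds (F w0).1) := by
      rw [tendsto_iff_dist_tendsto_zero]
      refine squeeze_zero' (Filter.Eventually.of_forall fun _ => dist_nonneg)
        (g := fun w => M * dPar w w0) ?_ (by simpa using hd0.const_mul M)
      filter_upwards [self_mem_nhdsWithin] with w hw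
      rw [Real.dist_eq]
      exact hA1 w (hKQ hw) w0 (hKQ hw0)
    have e2 : Filter.Tendsto (fun w => (F w).2)
        (nhdsWithin w0 (Set.Icc y0 y1 ×ˢ Set.Icc t0 t1)) (nhds (F w0).2) := by
      rw [tendsto_iff_dist_tendsto_zero]
      have e := hd0.const_mul M
      refine squeeze_zero' (Filter.Eventually.of_forall fun _ => dist_nonneg)
        (g := fun w => (M * dPar w w0) ^ 2 + ρ / 4 * (M * dPar w w0)) ?_
        (by simpa using (e.pow 2).add (e.const_mul (ρ / 4)))
      filter_upwards [self_mem_nhdsWithin] with w hw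
      rw [Real.dist_eq]
      exact hA2 w (hKQ hw) w0 (hKQ hw0)
    have := e1.prodMk_nhds e2
    exact this
  -- horizontal stretch
  have hstretch : 8 * (ρ * M ^ 2) ≤ |(F (y1, t0)).1 - (F (y0, t0)).1| := by
    have b := hB (y1, t0) (hKQ ⟨my1, mt0⟩) (y0, t0) (hKQ ⟨my0, mt0⟩)
    have c := hC (y1, t0) (hKQ ⟨my1, mt0⟩) (y0, t0) (hKQ ⟨my0, mt0⟩) rfl
    have d : dPar (y1, t0) (y0, t0) = h := by
      simp [dPar, hy1, abs_of_pos hh0, hh0.le]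
    rw [d] at b
    set Δ := |(F (y1, t0)).1 - (F (y0, t0)).1| with hΔ
    have hsq : ((F (y1, t0)).1 - (F (y0, t0)).1) ^ 2 = Δ ^ 2 := (sq_abs _).symm
    rw [hsq] at b
    by_contra hlt
    push Not at hlt
    have hΔ0 : 0 ≤ Δ := abs_nonneg _
    have e : h ^ 2 = M ^ 2 * (256 * (ρ * M ^ 2) ^ 2) := by rw [hh]; ring
    rw [e] at b
    have b' := le_of_mul_le_mul_left b (by positivity)
    have hκ : ρ ≤ ρ * M ^ 2 := by nlinarith
    generalize ρ * M ^ 2 = κ at *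
    rcases le_max_iff.1 b' with b1 | b1
    · nlinarith
    · nlinarith
  set u := (F (y0, t0)).1 with hu
  set v := (F (y1, t0)).1 with hv
  set m1 := (u + v) / 2 with hm1
  obtain ⟨σ, hσ, hσx⟩ := sign_exists (v - u)
  have hMs : M * s = ρ * M ^ 2 := by rw [hs]; ring
  have hκ0 : 0 < ρ * M ^ 2 := by positivity
  have hvert : ∀ y ∈ Set.Icc y0 y1, ∀ t ∈ Set.Icc t0 t1,
      |(F (y, t)).1 - (F (y, t0)).1| ≤ ρ * M ^ 2 := by
    intro y hyy t htt
    refine (hA1 _ (hKQ ⟨hyy, htt⟩) _ (hKQ ⟨hyy, mt0⟩)).trans ?_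
    rw [← hMs]
    refine mul_le_mul_of_nonneg_left ?_ hM0.le
    refine max_le (by simp [hs0.le]) ?_
    rw [← Real.sqrt_sq hs0.le]
    refine Real.sqrt_le_sqrt ?_
    simp only
    rw [abs_of_nonneg (by linarith [htt.1])]
    linarith [htt.2]
  have hleft : ∀ t ∈ Set.Icc t0 t1, σ * ((F (y0, t)).1 - m1) ≤ -(3 * (ρ * M ^ 2)) := by
    intro t htt
    have a1 := (le_abs_self _).trans ((sign_mul_le hσ _).trans (hvert y0 my0 t htt))
    have a2 : σ * ((F (y0, t)).1 - m1) = σ * ((F (y0, t)).1 - (F (y0, t0)).1) - σ * (v - u) / 2 := by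
      rw [hm1, ← hu]; ring
    rw [a2, hσx]
    linarith
  have hright : ∀ t ∈ Set.Icc t0 t1, 3 * (ρ * M ^ 2) ≤ σ * ((F (y1, t)).1 - m1) := by
    intro t htt
    have a1 := (neg_le_abs _).trans ((sign_mul_le hσ _).trans (hvert y1 my1 t htt))
    have a2 : σ * ((F (y1, t)).1 - m1) = σ * ((F (y1, t)).1 - (F (y1, t0)).1) + σ * (v - u) / 2 := by
      rw [hm1, ← hv]; ring
    rw [a2, hσx]
    linarith
  have hσ0 : σ ≠ 0 := by rintro rfl; simp at hσ
  have hmid : ∀ t ∈ Set.Icc t0 t1, ∃ y ∈ Set.Icc y0 y1, (F (y, t)).1 = m1 := by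
    intro t htt
    have hc : ContinuousOn (fun y => σ * ((F (y, t)).1 - m1)) (Set.Icc y0 y1) := by
      have : ContinuousOn (fun y => F (y, t)) (Set.Icc y0 y1) :=
        hFc.comp (by fun_prop) (fun y hyy => ⟨hyy, htt⟩)
      exact continuousOn_const.mul ((continuous_fst.comp_continuousOn this).sub continuousOn_const)
    obtain ⟨y, hyy, e⟩ := intermediate_value_Icc hy hc
      (show (0 : ℝ) ∈ _ from ⟨by linarith [hleft t htt], by linarith [hright t htt]⟩)
    refine ⟨y, hyy, ?_⟩
    have := (mul_eq_zero.1 e).resolve_left hσ0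
    linarith
  obtain ⟨ya, hya, ea⟩ := hmid t0 mt0
  obtain ⟨yb, hyb, eb⟩ := hmid t1 mt1
  set α := (F (ya, t0)).2 with hα
  set β := (F (yb, t1)).2 with hβ
  have hgap : ρ ^ 2 ≤ |β - α| := by
    have b := hB (yb, t1) (hKQ ⟨hyb, mt1⟩) (ya, t0) (hKQ ⟨hya, mt0⟩)
    have d : s ≤ dPar (yb, t1) (ya, t0) := by
      refine le_trans ?_ (le_max_right _ _)
      simp [ht1, Real.sqrt_sq hs0.le]
    rw [ea, eb, ← hα, ← hβ] at b
    simp only [sub_self, abs_zero, mul_zero, add_zero] at b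
    have e : M ^ 2 * ρ ^ 2 ≤ dPar (yb, t1) (ya, t0) ^ 2 := by
      have : s ^ 2 ≤ dPar (yb, t1) (ya, t0) ^ 2 := by gcongr
      calc M ^ 2 * ρ ^ 2 = s ^ 2 := by rw [hs]; ring
        _ ≤ _ := this
    have b' := le_of_mul_le_mul_left (e.trans b) (by positivity)
    rcases le_max_iff.1 b' with b1 | b1
    · nlinarith
    · exact b1
  obtain ⟨τ, hτ, hτx⟩ := sign_exists (β - α)
  have hτ0 : τ ≠ 0 := by rintro rfl; simp at hτ
  refine ⟨m1, (α + β) / 2, ?_⟩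
  rintro ⟨a, z⟩ ⟨⟨ha1, ha2⟩, ⟨hz1, hz2⟩⟩
  simp only at ha1 ha2 hz1 hz2
  have hσa : |σ * (a - m1)| ≤ 2 * (ρ * M ^ 2) :=
    (sign_mul_le hσ _).trans (abs_le.2 ⟨by linarith, by linarith⟩)
  have hτz : |τ * (z - (α + β) / 2)| < ρ ^ 2 / 4 :=
    (sign_mul_le hτ _).trans_lt (abs_lt.2 ⟨by linarith, by linarith⟩)
  rw [abs_le] at hσa
  rw [abs_lt] at hτz
  obtain ⟨w, hw, hw0⟩ := poincare_miranda
    (fun w => (σ * ((F w).1 - a), τ * ((F w).2 - z))) y0 y1 t0 t1 hy ht (by fun_prop)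
    (by
      intro t htt
      have := hleft t htt
      have e : σ * ((F (y0, t)).1 - a) = σ * ((F (y0, t)).1 - m1) - σ * (a - m1) := by ring
      simp only
      rw [e]; linarith)
    (by
      intro t htt
      have := hright t htt
      have e : σ * ((F (y1, t)).1 - a) = σ * ((F (y1, t)).1 - m1) - σ * (a - m1) := by ring
      simp only
      rw [e]; linarith)
    (by
      intro y hyy
      have c := (le_abs_self _).trans ((sign_mul_le hτ _).trans
        (hC (y, t0) (hKQ ⟨hyy, mt0⟩) (ya, t0) (hKQ ⟨hya, mt0⟩) rfl))
      have e : τ * ((F (y, t0)).2 - z) = τ * ((F (y, t0)).2 - (F (ya, t0)).2) - τ * (β - α) / 2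
        - τ * (z - (α + β) / 2) := by rw [← hα]; ring
      simp only
      rw [e, hτx]; nlinarith)
    (by
      intro y hyy
      have c := (neg_le_abs _).trans ((sign_mul_le hτ _).trans
        (hC (y, t1) (hKQ ⟨hyy, mt1⟩) (yb, t1) (hKQ ⟨hyb, mt1⟩) rfl))
      have e : τ * ((F (y, t1)).2 - z) = τ * ((F (y, t1)).2 - (F (yb, t1)).2) + τ * (β - α) / 2
        - τ * (z - (α + β) / 2) := by rw [← hβ]; ring
      simp only
      rw [e, hτx]; nlinarith)
  rw [Prod.mk.injEq] at hw0
  refine ⟨w, hKQ hw, Prod.ext ?_ ?_⟩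
  · have := (mul_eq_zero.1 hw0.1).resolve_left hσ0
    simp only; linarith
  · have := (mul_eq_zero.1 hw0.2).resolve_left hτ0
    simp only; linarith

theorem Rrot_Hmul (θ : ℝ) (p q : Hei) : Rrot θ (Hmul p q) = Hmul (Rrot θ p) (Rrot θ q) := by
  have h1 : Real.cos θ ^ 2 = 1 - Real.sin θ ^ 2 := by linarith [Real.sin_sq_add_cos_sq θ]
  unfold Rrot Hmul
  refine Prod.ext (by simp only; ring) (Prod.ext (by simp only; ring) ?_)
  simp only
  ring_nf
  rw [h1]
  ring

theorem dH_rot (θ : ℝ) (p q : Hei) : dH (Rrot θ p) (Rrot θ q) = dH p q := by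
  have h1 : Real.cos θ ^ 2 = 1 - Real.sin θ ^ 2 := by linarith [Real.sin_sq_add_cos_sq θ]
  have h2 : Hinv (Rrot θ q) = Rrot θ (Hinv q) := by
    unfold Hinv Rrot
    refine Prod.ext (by simp only; ring) (Prod.ext (by simp only; ring) rfl)
  unfold dH
  rw [h2, ← Rrot_Hmul]
  generalize Hmul (Hinv q) p = z
  unfold Hnorm Rrot
  simp only
  congr 2
  ring_nf
  rw [h1]
  ring

/-- The vertical component of `q⁻¹ p`. -/
noncomputable def vcomp (p q : Hei) : ℝ :=
  -q.2.2 + p.2.2 + (-q.1 * p.2.1 - p.1 * -q.2.1) / 2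

theorem dH_nonneg (p q : Hei) : 0 ≤ dH p q := le_max_of_le_left (Real.sqrt_nonneg _)

theorem dH_facts (p q : Hei) : |p.1 - q.1| ≤ dH p q ∧ |p.2.1 - q.2.1| ≤ dH p q ∧
    |vcomp p q| ≤ dH p q ^ 2 ∧
    dH p q ^ 2 ≤ max ((p.1 - q.1) ^ 2 + (p.2.1 - q.2.1) ^ 2) |vcomp p q| := by
  have e : dH p q = max (Real.sqrt ((p.1 - q.1) ^ 2 + (p.2.1 - q.2.1) ^ 2))
      (Real.sqrt |vcomp p q|) := by
    unfold dH Hnorm Hmul Hinv vcomp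
    simp only
    congr 2
    ring
  have n1 : 0 ≤ (p.1 - q.1) ^ 2 + (p.2.1 - q.2.1) ^ 2 := by positivity
  refine ⟨?_, ?_, ?_, ?_⟩
  · rw [e]
    refine le_max_of_le_left (Real.abs_le_sqrt ?_)
    nlinarith [sq_nonneg (p.2.1 - q.2.1)]
  · rw [e]
    refine le_max_of_le_left (Real.abs_le_sqrt ?_)
    nlinarith [sq_nonneg (p.1 - q.1)]
  · have : Real.sqrt |vcomp p q| ≤ dH p q := by rw [e]; exact le_max_right _ _
    rw [← Real.sq_sqrt (abs_nonneg (vcomp p q))]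
    gcongr
  · rw [e]
    rcases le_total (Real.sqrt ((p.1 - q.1) ^ 2 + (p.2.1 - q.2.1) ^ 2))
      (Real.sqrt |vcomp p q|) with h | h
    · rw [max_eq_right h, Real.sq_sqrt (abs_nonneg _)]
      exact le_max_right _ _
    · rw [max_eq_left h, Real.sq_sqrt n1]
      exact le_max_left _ _

/-- Planar coordinates of the vertical projection, sheared by `b`. -/
noncomputable def shp (b : ℝ) (p : Hei) : ℝ × ℝ :=
  (p.2.1, p.2.2 + p.1 * p.2.1 / 2 - b * p.2.1)

theorem shp_diff (b e : ℝ) (p q : Hei) (hp : |p.1 - b| ≤ e) (hq : |q.1 - b| ≤ e) :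
    |((shp b p).2 - (shp b q).2) - vcomp p q| ≤ e * |p.2.1 - q.2.1| := by
  have : ((shp b p).2 - (shp b q).2) - vcomp p q
      = ((p.1 - b) / 2 + (q.1 - b) / 2) * (p.2.1 - q.2.1) := by
    unfold shp vcomp; simp only; ring
  rw [this, abs_mul]
  refine mul_le_mul_of_nonneg_right ?_ (abs_nonneg _)
  rw [abs_le] at *
  exact ⟨by linarith, by linarith⟩

theorem line_in_plane (θ b : ℝ) (V L : Set Hei) (hb : Rrot (-θ) '' V = {p : Hei | p.1 = b})
    (hL : IsHorizontalLine L) (hLV : L ⊆ V) :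
    L.Nonempty ∧ ∃ c : ℝ, ∀ q ∈ L, (Rrot (-θ) q).1 = b ∧ (shp b (Rrot (-θ) q)).2 = c := by
  obtain ⟨p, v, -, rfl⟩ := hL
  have hx : ∀ s : ℝ, (Rrot (-θ) (Hmul p (s * v.1, s * v.2, 0))).1 = b := by
    intro s
    have : Rrot (-θ) (Hmul p (s * v.1, s * v.2, 0)) ∈ {p : Hei | p.1 = b} := by
      rw [← hb]
      exact ⟨_, hLV ⟨s, rfl⟩, rfl⟩
    exact this
  refine ⟨⟨_, 0, rfl⟩, p.2.2 + b * (Rrot (-θ) p).2.1 / 2 - b * (Rrot (-θ) p).2.1, ?_⟩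
  rintro _ ⟨s, rfl⟩
  refine ⟨hx s, ?_⟩
  have h0 := hx 0
  have h1 := hx 1
  have hs := hx s
  rw [Rrot_Hmul] at *
  set p' := Rrot (-θ) p with hp'
  set v' := Rrot (-θ) (v.1, v.2, 0) with hv'
  have ev : ∀ r : ℝ, Rrot (-θ) (r * v.1, r * v.2, 0) = (r * v'.1, r * v'.2.1, 0) := by
    intro r
    rw [hv']
    unfold Rrot
    refine Prod.ext (by simp only; ring) (Prod.ext (by simp only; ring) rfl)
  rw [ev] at *
  have e3 : p'.2.2 = p.2.2 := rfl
  unfold shp Hmul at *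
  simp only at *
  have k0 : p'.1 = b := by linarith
  have k1 : v'.1 = 0 := by linarith
  rw [e3, k0, k1]
  ring

theorem shear_measure (b : ℝ) (R : Set (ℝ × ℝ)) (hR : MeasurableSet R) :
    MeasureTheory.volume ((fun w : ℝ × ℝ => (w.1, w.2 - b * w.1)) ⁻¹' R)
      = MeasureTheory.volume R := by
  have : MeasureTheory.MeasurePreserving (fun w : ℝ × ℝ => (w.1, w.2 - b * w.1))
      (MeasureTheory.volume.prod MeasureTheory.volume)
      (MeasureTheory.volume.prod MeasureTheory.volume) := by
    refine (MeasureTheory.MeasurePreserving.id MeasureTheory.volume).skew_product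
      (g := fun x y => y - b * x) ?_ (Filter.Eventually.of_forall fun x => ?_)
    · unfold Function.uncurry; fun_prop
    · exact MeasureTheory.map_sub_right_eq_self MeasureTheory.volume (b * x)
  exact this.measure_preimage hR.nullMeasurableSet

theorem sheared_image (M ρ y0 t0 b : ℝ) (hM : 1 ≤ M) (hρ : 0 < ρ) (Q : Set (ℝ × ℝ))
    (hQ : Q = Set.Ico y0 (y0 + 32 * ρ * M ^ 3) ×ˢ Set.Ico t0 (t0 + (32 * ρ * M ^ 3) ^ 2))
    (g : ℝ × ℝ → Hei) (hg : IsBilipschitz M g)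
    (hL : ∀ t : ℝ, ∃ c : ℝ, ∀ w ∈ Q, w.2 = t →
      ∃ q : Hei, q.1 = b ∧ (shp b q).2 = c ∧ dH (g w) q ≤ ρ / 4) :
    ∃ m1 m2 : ℝ, Set.Ioo (m1 - 2 * (ρ * M ^ 2)) (m1 + 2 * (ρ * M ^ 2)) ×ˢ
      Set.Ioo (m2 - ρ ^ 2 / 4) (m2 + ρ ^ 2 / 4) ⊆ (fun w => shp b (g w)) '' Q := by
  have hM0 : 0 < M := by linarith
  have hx : ∀ w ∈ Q, |(g w).1 - b| ≤ ρ / 4 := by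
    intro w hw
    obtain ⟨c, hc⟩ := hL w.2
    obtain ⟨q, h1, -, h3⟩ := hc w hw rfl
    rw [← h1]
    exact (dH_facts _ _).1.trans h3
  have hdn : ∀ w w', 0 ≤ dPar w w' := fun w w' => le_max_of_le_left (abs_nonneg _)
  refine planar M ρ y0 t0 hM hρ Q hQ (fun w => shp b (g w)) ?_ ?_ ?_ ?_
  · intro w _ w' _
    exact (dH_facts (g w) (g w')).2.1.trans (hg w w').2
  · intro w hw w' hw'
    have d := shp_diff b (ρ / 4) (g w) (g w') (hx w hw) (hx w' hw')
    obtain ⟨-, f2, f3, -⟩ := dH_facts (g w) (g w')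
    have f5 := (hg w w').2
    have f6 := dH_nonneg (g w) (g w')
    have a1 : |vcomp (g w) (g w')| ≤ (M * dPar w w') ^ 2 := f3.trans (by gcongr)
    have a2 : ρ / 4 * |(g w).2.1 - (g w').2.1| ≤ ρ / 4 * (M * dPar w w') := by
      gcongr; exact f2.trans f5
    have := abs_sub_abs_le_abs_sub ((shp b (g w)).2 - (shp b (g w')).2) (vcomp (g w) (g w'))
    linarith
  · intro w hw w' hw'
    have d := shp_diff b (ρ / 4) (g w) (g w') (hx w hw) (hx w' hw')
    obtain ⟨-, -, -, f4⟩ := dH_facts (g w) (g w')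
    have f5 := (hg w w').1
    have k : dPar w w' ≤ M * dH (g w) (g w') := by
      rw [inv_mul_le_iff₀ hM0] at f5; exact f5
    have k2 : dPar w w' ^ 2 ≤ M ^ 2 * dH (g w) (g w') ^ 2 := by
      rw [← mul_pow]; exact pow_le_pow_left₀ (hdn _ _) k 2
    refine k2.trans (mul_le_mul_of_nonneg_left (f4.trans (max_le_max ?_ ?_)) (by positivity))
    · have h1 := hx w hw
      have h2 := hx w' hw'
      have h3 : |(g w).1 - (g w').1| ≤ 2 * (ρ / 4) := by
        rw [abs_le] at *
        exact ⟨by linarith, by linarith⟩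
      have h4 : ((g w).1 - (g w').1) ^ 2 ≤ (2 * (ρ / 4)) ^ 2 := sq_le_sq' (abs_le.1 h3).1 (abs_le.1 h3).2
      have h5 : ((shp b (g w)).1 - (shp b (g w')).1) = (g w).2.1 - (g w').2.1 := rfl
      rw [h5]
      linarith
    · have := abs_sub_abs_le_abs_sub (vcomp (g w) (g w')) ((shp b (g w)).2 - (shp b (g w')).2)
      rw [abs_sub_comm] at d
      have h5 : ((shp b (g w)).1 - (shp b (g w')).1) = (g w).2.1 - (g w').2.1 := rfl
      rw [h5]
      linarith
  · intro w hw w' hw' hww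
    obtain ⟨c, hc⟩ := hL w.2
    have key : ∀ w ∈ Q, (∃ q : Hei, q.1 = b ∧ (shp b q).2 = c ∧ dH (g w) q ≤ ρ / 4) →
        |(shp b (g w)).2 - c| ≤ 2 * (ρ / 4) ^ 2 := by
      rintro w hw ⟨q, h1, h2, h3⟩
      have d := shp_diff b (ρ / 4) (g w) q (hx w hw) (by rw [h1, sub_self, abs_zero]; positivity)
      obtain ⟨-, f2, f3, -⟩ := dH_facts (g w) q
      have f6 := dH_nonneg (g w) q
      have a1 : |vcomp (g w) q| ≤ (ρ / 4) ^ 2 := f3.trans (by gcongr)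
      have a2 : ρ / 4 * |(g w).2.1 - q.2.1| ≤ ρ / 4 * (ρ / 4) := by
        gcongr; exact f2.trans h3
      have := abs_sub_abs_le_abs_sub ((shp b (g w)).2 - (shp b q).2) (vcomp (g w) q)
      rw [← h2]
      linarith
    have a := key w hw (hc w hw rfl)
    have a' := key w' hw' (hc w' hw' hww.symm)
    rw [abs_le] at *
    exact ⟨by linarith, by linarith⟩

/-- **Corollary 4.5.** Projections of images of flat rectangles are large. -/
theorem projection_of_flat_rectangle_lower_bound :
    ∀ M : ℝ, 1 ≤ M → ∃ δ > (0 : ℝ), ∃ ε > (0 : ℝ),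
      ∀ f : ℝ × ℝ → Hei, IsBilipschitz M f →
        ∀ θ ∈ Set.Ico (-(Real.pi / 2)) (Real.pi / 2), ∀ i : Idx,
          (∃ V : Set Hei, IsVerticalPlane V ∧ SlopeZeroRel θ V ∧
            ∀ t : ℝ, ∃ L : Set Hei, IsHorizontalLine L ∧ L ⊆ V ∧
              f '' (lineW t ∩ rect i) ⊆ NH L (ε * sideLen i)) →
          ENNReal.ofReal δ * H3 (embedW '' rect i) ≤ H3 (PiTheta θ '' (f '' rect i)) := by
  intro M hM
  have hM0 : 0 < M := by linarith
  refine ⟨1 / (16384 * M ^ 7), by positivity, 1 / (256 * M ^ 3), by positivity, ?_⟩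
  rintro f hf θ - i ⟨V, -, ⟨b, hb⟩, hV⟩
  set l := sideLen i with hl
  have hl0 : 0 < l := zpow_pos (by norm_num) _
  set y0 : ℝ := (i.2.1 : ℝ) * l with hy0
  set t0 : ℝ := (i.2.2 : ℝ) * l ^ 2 with ht0
  have hl4 : (4 : ℝ) ^ (-i.1) = l ^ 2 := by
    rw [hl, sideLen, ← zpow_natCast, ← zpow_mul, mul_comm, zpow_mul]
    norm_num
  have hrect : rect i = Set.Ico y0 (y0 + l) ×ˢ Set.Ico t0 (t0 + l ^ 2) := by
    unfold rect
    rw [hl4, hy0, ht0, add_one_mul, add_one_mul]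
    rfl
  set ρ : ℝ := l / (32 * M ^ 3) with hρ
  have hρ0 : 0 < ρ := by positivity
  have hlρ : l = 32 * ρ * M ^ 3 := by rw [hρ]; field_simp
  set g : ℝ × ℝ → Hei := fun w => Rrot (-θ) (f w) with hg
  have hgb : IsBilipschitz M g := by
    intro w w'
    simp only [hg]
    rw [dH_rot]
    exact hf w w'
  have hL : ∀ t : ℝ, ∃ c : ℝ, ∀ w ∈ rect i, w.2 = t →
      ∃ q : Hei, q.1 = b ∧ (shp b q).2 = c ∧ dH (g w) q ≤ ρ / 4 := by
    intro t
    obtain ⟨L, hL1, hL2, hL3⟩ := hV t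
    obtain ⟨hne, c, hc⟩ := line_in_plane θ b V L hb hL1 hL2
    refine ⟨c, fun w hw hwt => ?_⟩
    have hd : distH (f w) L ≤ 1 / (256 * M ^ 3) * l := hL3 ⟨w, ⟨hwt, hw⟩, rfl⟩
    have hlt : distH (f w) L < ρ / 4 := by
      refine hd.trans_lt ?_
      have : ρ / 4 = 2 * (1 / (256 * M ^ 3) * l) := by rw [hρ]; field_simp; norm_num
      have h0 : 0 < 1 / (256 * M ^ 3) * l := by positivity
      linarith
    obtain ⟨_, ⟨q, hq, rfl⟩, hq'⟩ := exists_lt_of_csInf_lt (hne.image _) hlt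
    refine ⟨Rrot (-θ) q, (hc q hq).1, (hc q hq).2, ?_⟩
    simp only [hg]
    rw [dH_rot]
    exact hq'.le
  obtain ⟨m1, m2, hsub⟩ := sheared_image M ρ y0 t0 b hM hρ0 (rect i)
    (by rw [hrect, ← hlρ]) g hgb hL
  set R := Set.Ioo (m1 - 2 * (ρ * M ^ 2)) (m1 + 2 * (ρ * M ^ 2)) ×ˢ
      Set.Ioo (m2 - ρ ^ 2 / 4) (m2 + ρ ^ 2 / 4) with hR
  have hvolR : MeasureTheory.volume R = ENNReal.ofReal (1 / (16384 * M ^ 7) * l ^ 3) := by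
    rw [hR, MeasureTheory.Measure.volume_eq_prod, MeasureTheory.Measure.prod_prod,
      Real.volume_Ioo, Real.volume_Ioo, ← ENNReal.ofReal_mul]
    · congr 1
      rw [hlρ]
      field_simp
      ring
    · have : 0 < ρ * M ^ 2 := by positivity
      linarith
  have himg : PiTheta θ '' (f '' rect i)
      = (fun w => Rrot θ (embedW w)) '' ((fun w => shp 0 (g w)) '' rect i) := by
    rw [Set.image_image, Set.image_image]
    refine Set.image_congr fun w _ => ?_
    simp only [PiTheta, Piproj, shp, embedW, hg, zero_mul, sub_zero]
  have hpre : (fun w : ℝ × ℝ => (w.1, w.2 - b * w.1)) ⁻¹' R ⊆ (fun w => shp 0 (g w)) '' rect i := by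
    intro z hz
    obtain ⟨w, hw, e⟩ := hsub hz
    refine ⟨w, hw, ?_⟩
    simp only [shp, Prod.mk.injEq] at e
    refine Prod.ext e.1 ?_
    simp only [shp]
    have := e.2
    rw [e.1] at this
    rw [e.1]
    linarith
  calc ENNReal.ofReal (1 / (16384 * M ^ 7)) * H3 (embedW '' rect i)
      ≤ ENNReal.ofReal (1 / (16384 * M ^ 7)) * ENNReal.ofReal (l ^ 3) := by
        gcongr
        rw [hrect]
        exact H3_upper y0 t0 l hl0
    _ = MeasureTheory.volume R := by
        rw [hvolR, ENNReal.ofReal_mul (by positivity)]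
    _ = MeasureTheory.volume ((fun w : ℝ × ℝ => (w.1, w.2 - b * w.1)) ⁻¹' R) :=
        (shear_measure b R (measurableSet_Ioo.prod measurableSet_Ioo)).symm
    _ ≤ MeasureTheory.volume ((fun w => shp 0 (g w)) '' rect i) :=
        MeasureTheory.measure_mono hpre
    _ ≤ H3 (PiTheta θ '' (f '' rect i)) := by
        rw [himg]
        exact H3_lower θ _

end HeisRug
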